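/- Let n ∈ ℕ, let d₁, d̂₀, …, d̂ₙ ∈ ℂ and b₀ ∈ ℂ∖{0}. Then the assignment k(x_1) = qx_1, k(x_2) = q⁻²x_2, k(x_3) = q⁻¹x_3, e(x_1) = 0, e(x_2) = b₀·1, e(x_3) = 0, f(x_1) = d₁x_3 + b₀⁻¹x_1x_2 + Σ_{p=0}^{n} d̂ₚ x_1^{p+1}x_3^{p+2}, f(x_2) = −qb₀⁻¹x_2², f(x_3) = −qb₀⁻¹x_2x_3 − Σ_{p=0}^{n} (q·(p+1)_q/(p+3)_q)·d̂ₚ x_1^{p}x_3^{p+3}, extended by the module-algebra conditions, defines a module-algebra structure of U_q(sl(2)) on the quantum 3-space A_q(3). -/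

import Mathlib

noncomputable section

open scoped BigOperators

/-- The defining relations of the quantum `n`-space `A_q(n)`:
`x_i x_j = q • (x_j x_i)` for `i > j`. -/
inductive QRel (q : ℂ) (n : ℕ) : FreeAlgebra ℂ (Fin n) → FreeAlgebra ℂ (Fin n) → Prop
  | rel (i j : Fin n) (h : j < i) :
      QRel q n (FreeAlgebra.ι ℂ i * FreeAlgebra.ι ℂ j)
        (q • (FreeAlgebra.ι ℂ j * FreeAlgebra.ι ℂ i))

/-- The quantum `n`-space `A_q(n)`. -/
abbrev QSpace (q : ℂ) (n : ℕ) : Type := RingQuot (QRel q n)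

/-- The generator `x_i` of the quantum `n`-space. -/
def Xg (q : ℂ) (n : ℕ) (i : Fin n) : QSpace q n :=
  RingQuot.mkAlgHom ℂ (QRel q n) (FreeAlgebra.ι ℂ i)

/-- The Cartan matrix of `sl(m+1)`: `a_{ii} = 2`, `a_{ij} = -1` if `|i-j| = 1`,
`a_{ij} = 0` if `|i-j| > 1`. -/
def cartan (m : ℕ) (i j : Fin m) : ℤ :=
  if i = j then 2 else if ((i : ℤ) - (j : ℤ)).natAbs = 1 then -1 else 0

/-- A module-algebra structure of `U_q(sl(m+1))` on a unital `ℂ`-algebra `A`: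
`ℂ`-linear maps `k_i` (unital algebra automorphisms with two-sided inverses `(k i).symm`),
`e_i`, `f_i` for `1 ≤ i ≤ m`, satisfying the twisted Leibniz rules and the defining
operator relations of `U_q(sl(m+1))`. -/
structure UqslMA (q : ℂ) (m : ℕ) (A : Type) [Ring A] [Algebra ℂ A] where
  k : Fin m → (A ≃ₐ[ℂ] A)
  e : Fin m → (A →ₗ[ℂ] A)
  f : Fin m → (A →ₗ[ℂ] A)
  e_mul : ∀ (i : Fin m) (a b : A), e i (a * b) = a * e i b + e i a * k i b
  f_mul : ∀ (i : Fin m) (a b : A), f i (a * b) = (k i).symm a * f i b + f i a * b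
  e_one : ∀ i : Fin m, e i 1 = 0
  f_one : ∀ i : Fin m, f i 1 = 0
  k_comm : ∀ (i j : Fin m) (a : A), k i (k j a) = k j (k i a)
  ke : ∀ (i j : Fin m) (a : A), k i (e j ((k i).symm a)) = q ^ cartan m i j • e j a
  kf : ∀ (i j : Fin m) (a : A), k i (f j ((k i).symm a)) = q ^ (-cartan m i j) • f j a
  ef : ∀ (i j : Fin m) (a : A),
      e i (f j a) - f j (e i a) =
        if i = j then (q - q⁻¹)⁻¹ • (k i a - (k i).symm a) else 0
  ee_comm : ∀ i j : Fin m, cartan m i j = 0 → ∀ a : A, e i (e j a) = e j (e i a)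
  ff_comm : ∀ i j : Fin m, cartan m i j = 0 → ∀ a : A, f i (f j a) = f j (f i a)
  serre_e : ∀ i j : Fin m, cartan m i j = -1 → ∀ a : A,
      e i (e i (e j a)) - (q + q⁻¹) • e i (e j (e i a)) + e j (e i (e i a)) = 0
  serre_f : ∀ i j : Fin m, cartan m i j = -1 → ∀ a : A,
      f i (f i (f j a)) - (q + q⁻¹) • f i (f j (f i a)) + f j (f i (f i a)) = 0

/-- Isomorphism of module-algebra structures: an algebra automorphism `ψ` of `A` with
`ψ ∘ π₁(h) ∘ ψ⁻¹ = π₂(h)` for every generator `h ∈ {k_i^{±1}, e_i, f_i}`. -/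
def UqslMA.Iso {q : ℂ} {m : ℕ} {A : Type} [Ring A] [Algebra ℂ A]
    (π₁ π₂ : UqslMA q m A) : Prop :=
  ∃ ψ : A ≃ₐ[ℂ] A,
    (∀ (i : Fin m) (a : A), ψ (π₁.k i (ψ.symm a)) = π₂.k i a) ∧
    (∀ (i : Fin m) (a : A), ψ ((π₁.k i).symm (ψ.symm a)) = (π₂.k i).symm a) ∧
    (∀ (i : Fin m) (a : A), ψ (π₁.e i (ψ.symm a)) = π₂.e i a) ∧
    (∀ (i : Fin m) (a : A), ψ (π₁.f i (ψ.symm a)) = π₂.f i a)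

/-- The generator `x_1` of the quantum 3-space. -/
def Z1 (q : ℂ) : QSpace q 3 := Xg q 3 0
/-- The generator `x_2` of the quantum 3-space. -/
def Z2 (q : ℂ) : QSpace q 3 := Xg q 3 1
/-- The generator `x_3` of the quantum 3-space. -/
def Z3 (q : ℂ) : QSpace q 3 := Xg q 3 2

/-- The `q`-integer `(n)_q = (qⁿ − 1)/(q − 1)`. -/
def qInt (q : ℂ) (n : ℕ) : ℂ := (q ^ n - 1) / (q - 1)

namespace QSpace

variable {q : ℂ} {n : ℕ}

theorem Xg_mul_Xg {i j : Fin n} (h : j < i) :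
    Xg q n i * Xg q n j = q • (Xg q n j * Xg q n i) := by
  have := RingQuot.mkAlgHom_rel ℂ (QRel.rel (q := q) i j h)
  simpa only [Xg, map_mul, map_smul] using this

/-- The universal property of the quantum `n`-space. -/
theorem exists_algHom {B : Type*} [Ring B] [Algebra ℂ B] (y : Fin n → B)
    (hy : ∀ i j, j < i → y i * y j = q • (y j * y i)) :
    ∃ φ : QSpace q n →ₐ[ℂ] B, ∀ i, φ (Xg q n i) = y i := by
  refine ⟨RingQuot.liftAlgHom ℂ ⟨FreeAlgebra.lift ℂ y, ?_⟩, fun i => ?_⟩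
  · rintro _ _ ⟨i, j, h⟩
    simpa using hy i j h
  · simp [Xg]

@[elab_as_elim]
theorem induction {C : QSpace q n → Prop} (hc : ∀ c : ℂ, C (algebraMap ℂ _ c))
    (hX : ∀ i, C (Xg q n i)) (hmul : ∀ a b, C a → C b → C (a * b))
    (hadd : ∀ a b, C a → C b → C (a + b)) (a : QSpace q n) : C a := by
  obtain ⟨a, rfl⟩ := RingQuot.mkAlgHom_surjective ℂ (QRel q n) a
  induction a using FreeAlgebra.induction with
  | grade0 c => simpa using hc c
  | grade1 i => exact hX i
  | mul a b ha hb => simpa using hmul _ _ ha hb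
  | add a b ha hb => simpa using hadd _ _ ha hb

theorem algHom_ext {B : Type*} [Ring B] [Algebra ℂ B] {φ ψ : QSpace q n →ₐ[ℂ] B}
    (h : ∀ i, φ (Xg q n i) = ψ (Xg q n i)) : φ = ψ := by
  refine AlgHom.ext fun a => ?_
  induction a using QSpace.induction with
  | hc c => simp
  | hX i => exact h i
  | hmul a b ha hb => simp [ha, hb]
  | hadd a b ha hb => simp [ha, hb]

/-- Any rescaling of the generators by nonzero scalars is an automorphism. -/
theorem exists_scaling (w : Fin n → ℂ) (hw : ∀ i, w i ≠ 0) :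
    ∃ κ : QSpace q n ≃ₐ[ℂ] QSpace q n, (∀ i, κ (Xg q n i) = w i • Xg q n i) ∧
      ∀ i, κ.symm (Xg q n i) = (w i)⁻¹ • Xg q n i := by
  have key (u : Fin n → ℂ) : ∃ φ : QSpace q n →ₐ[ℂ] QSpace q n,
      ∀ i, φ (Xg q n i) = u i • Xg q n i := by
    refine exists_algHom _ fun i j h => ?_
    rw [smul_mul_smul_comm, smul_mul_smul_comm, Xg_mul_Xg h, smul_comm q, mul_comm (u i)]
  obtain ⟨φ, hφ⟩ := key w
  obtain ⟨ψ, hψ⟩ := key fun i => (w i)⁻¹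
  refine ⟨AlgEquiv.ofAlgHom φ ψ (algHom_ext fun i => ?_) (algHom_ext fun i => ?_), hφ, hψ⟩
  · simp [hφ, hψ, smul_smul, hw]
  · simp [hφ, hψ, smul_smul, hw]

/-- A `(σ, τ)`-skew derivation of the quantum `n`-space. -/
structure IsSkewDerivation (σ τ : QSpace q n → QSpace q n)
    (D : QSpace q n →ₗ[ℂ] QSpace q n) : Prop where
  map_mul : ∀ a b, D (a * b) = σ a * D b + D a * τ b
  map_one : D 1 = 0

theorem IsSkewDerivation.eq {σ τ : QSpace q n → QSpace q n}
    {D E : QSpace q n →ₗ[ℂ] QSpace q n} (hD : IsSkewDerivation σ τ D)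
    (hE : IsSkewDerivation σ τ E) (h : ∀ i, D (Xg q n i) = E (Xg q n i)) : D = E := by
  refine LinearMap.ext fun a => ?_
  induction a using QSpace.induction with
  | hc c => simp [Algebra.algebraMap_eq_smul_one, hD.map_one, hE.map_one]
  | hX i => exact h i
  | hmul a b ha hb => rw [hD.map_mul, hE.map_mul, ha, hb]
  | hadd a b ha hb => rw [map_add, map_add, ha, hb]

/-- The values on the generators which a `(σ, τ)`-skew derivation may take. -/
def skewValues (σ τ : QSpace q n →ₐ[ℂ] QSpace q n) : Submodule ℂ (Fin n → QSpace q n) where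
  carrier := {v | ∀ i j, j < i → σ (Xg q n i) * v j + v i * τ (Xg q n j) =
    q • (σ (Xg q n j) * v i + v j * τ (Xg q n i))}
  zero_mem' := by intro i j _; simp
  add_mem' := by
    intro u v hu hv i j h
    have := congrArg₂ (· + ·) (hu i j h) (hv i j h)
    simp only [Pi.add_apply, mul_add, add_mul, smul_add] at this ⊢
    rw [add_add_add_comm, this]
    abel
  smul_mem' := by
    intro c v hv i j h
    have := congrArg (c • ·) (hv i j h)
    simp only [Pi.smul_apply, mul_smul_comm, smul_mul_assoc, ← smul_add] at this ⊢
    rw [this, smul_comm]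

theorem exists_isSkewDerivation (σ τ : QSpace q n →ₐ[ℂ] QSpace q n) {v : Fin n → QSpace q n}
    (hv : v ∈ skewValues σ τ) :
    ∃ D : QSpace q n →ₗ[ℂ] QSpace q n, IsSkewDerivation σ τ D ∧ ∀ i, D (Xg q n i) = v i := by
  obtain ⟨Φ, hΦ⟩ := exists_algHom (q := q)
    (fun i => !![σ (Xg q n i), v i; 0, τ (Xg q n i)]) fun i j h => by
      have hσ := congrArg σ (Xg_mul_Xg (q := q) h)
      have hτ := congrArg τ (Xg_mul_Xg (q := q) h)
      rw [map_mul, map_smul, map_mul] at hσ hτ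
      ext a b
      fin_cases a <;> fin_cases b <;> simp [Matrix.mul_apply, hσ, hτ]
      simpa using hv i j h
  have shape (a : QSpace q n) : Φ a 0 0 = σ a ∧ Φ a 1 0 = 0 ∧ Φ a 1 1 = τ a := by
    induction a using QSpace.induction with
    | hc c => simp [Matrix.algebraMap_matrix_apply]
    | hX i => simp [hΦ]
    | hmul a b ha hb => simp [Matrix.mul_apply, ha, hb]
    | hadd a b ha hb => simp [ha, hb]
  refine ⟨(Matrix.entryLinearMap ℂ (QSpace q n) (0 : Fin 2) (1 : Fin 2)).comp Φ.toLinearMap,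
    ⟨fun a b => ?_, ?_⟩, fun i => ?_⟩
  · simp [Matrix.mul_apply, shape]
  · simp
  · simp [hΦ]

theorem conj_smul_eq {κ : QSpace q n ≃ₐ[ℂ] QSpace q n} {σ τ : QSpace q n → QSpace q n}
    {D : QSpace q n →ₗ[ℂ] QSpace q n} (hD : IsSkewDerivation σ τ D)
    (hσ : ∀ a, κ (σ (κ.symm a)) = σ a) (hτ : ∀ a, κ (τ (κ.symm a)) = τ a) (c : ℂ)
    (h : ∀ i, κ (D (κ.symm (Xg q n i))) = c • D (Xg q n i)) (a : QSpace q n) :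
    κ (D (κ.symm a)) = c • D a := by
  have h1 : IsSkewDerivation σ τ (κ.toLinearMap ∘ₗ D ∘ₗ κ.symm.toLinearMap) :=
    ⟨fun a b => by simp [hD.map_mul, hσ, hτ], by simp [hD.map_one]⟩
  have h2 : IsSkewDerivation σ τ (c • D) :=
    ⟨fun a b => by simp [hD.map_mul], by simp [hD.map_one]⟩
  exact LinearMap.congr_fun (h1.eq h2 (by simpa using h)) a

theorem commutator_eq (hq : q ≠ 0) {κ : QSpace q n ≃ₐ[ℂ] QSpace q n}
    {e f : QSpace q n →ₗ[ℂ] QSpace q n}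
    (he : IsSkewDerivation id κ e) (hf : IsSkewDerivation κ.symm id f)
    (hke : ∀ a, κ (e (κ.symm a)) = q ^ (2 : ℤ) • e a)
    (hkf : ∀ a, κ (f (κ.symm a)) = q ^ (-2 : ℤ) • f a)
    (h : ∀ i, e (f (Xg q n i)) - f (e (Xg q n i)) =
      (q - q⁻¹)⁻¹ • (κ (Xg q n i) - κ.symm (Xg q n i))) (a : QSpace q n) :
    e (f a) - f (e a) = (q - q⁻¹)⁻¹ • (κ a - κ.symm a) := by
  have hek (a) : e (κ.symm a) = q ^ (2 : ℤ) • κ.symm (e a) := by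
    apply κ.injective
    simp [hke]
  have hkf' (a) : κ (f a) = q ^ (-2 : ℤ) • f (κ a) := by
    simpa using hkf (κ a)
  have h1 : IsSkewDerivation κ.symm κ (e ∘ₗ f - f ∘ₗ e) := by
    refine ⟨fun a b => ?_, by simp [he.map_one, hf.map_one]⟩
    have hqq : q ^ (2 : ℤ) * q ^ (-2 : ℤ) = 1 := by rw [← zpow_add₀ hq]; simp
    simp only [LinearMap.sub_apply, LinearMap.comp_apply, he.map_mul, hf.map_mul, map_add, id, hek,
      hkf', smul_mul_smul_comm, hqq, one_smul, mul_sub, sub_mul]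
    abel
  have h2 : IsSkewDerivation κ.symm κ ((q - q⁻¹)⁻¹ • (κ.toLinearMap - κ.symm.toLinearMap)) := by
    refine ⟨fun a b => ?_, by simp⟩
    simp only [LinearMap.smul_apply, LinearMap.sub_apply, AlgEquiv.toLinearMap_apply, map_mul,
      mul_smul_comm, smul_mul_assoc, ← smul_add, mul_sub, sub_mul]
    congr 1
    abel
  exact LinearMap.congr_fun (h1.eq h2 (by simpa using h)) a

/-- To give a `U_q(sl(2))`-module-algebra structure on the quantum `n`-space it suffices to
check all compatibilities on the generators. -/
theorem exists_uqslMA (hq : q ≠ 0) {κ : QSpace q n ≃ₐ[ℂ] QSpace q n}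
    {e f : QSpace q n →ₗ[ℂ] QSpace q n}
    (he : IsSkewDerivation id κ e) (hf : IsSkewDerivation κ.symm id f)
    (hke : ∀ i, κ (e (κ.symm (Xg q n i))) = q ^ (2 : ℤ) • e (Xg q n i))
    (hkf : ∀ i, κ (f (κ.symm (Xg q n i))) = q ^ (-2 : ℤ) • f (Xg q n i))
    (hef : ∀ i, e (f (Xg q n i)) - f (e (Xg q n i)) =
      (q - q⁻¹)⁻¹ • (κ (Xg q n i) - κ.symm (Xg q n i))) :
    ∃ π : UqslMA q 1 (QSpace q n), π.k 0 = κ ∧ π.e 0 = e ∧ π.f 0 = f := by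
  have cartan_eq (i j : Fin 1) : cartan 1 i j = 2 := by simp [cartan, Subsingleton.elim i j]
  have hke' := conj_smul_eq (κ := κ) he (by simp) (by simp) _ hke
  have hkf' := conj_smul_eq (κ := κ) hf (by simp) (by simp) _ hkf
  refine ⟨⟨fun _ => κ, fun _ => e, fun _ => f, fun _ => he.map_mul, fun _ => hf.map_mul,
    fun _ => he.map_one, fun _ => hf.map_one, fun _ _ _ => rfl, fun i j a => ?_, fun i j a => ?_,
    fun i j a => ?_, fun i j h => ?_, fun i j h => ?_, fun i j h => ?_, fun i j h => ?_⟩,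
    rfl, rfl, rfl⟩
  · rw [cartan_eq, hke']
  · rw [cartan_eq, hkf']
  · rw [if_pos (Subsingleton.elim i j), commutator_eq hq he hf hke' hkf' hef]
  all_goals simp [cartan_eq] at h

end QSpace

section QCommute

variable {q : ℂ} {A : Type*} [Ring A] [Algebra ℂ A] {a b : A}

theorem mul_pow_of_qcomm (h : b * a = q • (a * b)) (m : ℕ) :
    b * a ^ m = q ^ m • (a ^ m * b) := by
  induction m with
  | zero => simp
  | succ m ih =>
    rw [pow_succ, ← mul_assoc, ih, smul_mul_assoc, mul_assoc, h, mul_smul_comm, smul_smul,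
      mul_assoc, pow_succ]

theorem pow_mul_of_qcomm (h : b * a = q • (a * b)) (m : ℕ) :
    b ^ m * a = q ^ m • (a * b ^ m) := by
  induction m with
  | zero => simp
  | succ m ih =>
    rw [pow_succ', mul_assoc, ih, mul_smul_comm, ← mul_assoc, h, smul_mul_assoc, smul_smul,
      mul_assoc, pow_succ]

end QCommute

section QuantumThreeSpace

variable {q : ℂ}

theorem QSpace.mem_skewValues_three {σ τ : QSpace q 3 →ₐ[ℂ] QSpace q 3} {v₁ v₂ v₃ : QSpace q 3}
    (h21 : σ (Z2 q) * v₁ + v₂ * τ (Z1 q) = q • (σ (Z1 q) * v₂ + v₁ * τ (Z2 q)))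
    (h31 : σ (Z3 q) * v₁ + v₃ * τ (Z1 q) = q • (σ (Z1 q) * v₃ + v₁ * τ (Z3 q)))
    (h32 : σ (Z3 q) * v₂ + v₃ * τ (Z2 q) = q • (σ (Z2 q) * v₃ + v₂ * τ (Z3 q))) :
    ![v₁, v₂, v₃] ∈ QSpace.skewValues σ τ := by
  intro i j hij
  fin_cases i <;> fin_cases j <;> first | exact absurd hij (by decide) | skip
  exacts [h21, h31, h32]

theorem Z2_mul_Z1 : Z2 q * Z1 q = q • (Z1 q * Z2 q) := QSpace.Xg_mul_Xg (by decide)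

theorem Z3_mul_Z1 : Z3 q * Z1 q = q • (Z1 q * Z3 q) := QSpace.Xg_mul_Xg (by decide)

theorem Z3_mul_Z2 : Z3 q * Z2 q = q • (Z2 q * Z3 q) := QSpace.Xg_mul_Xg (by decide)

variable {κ : QSpace q 3 →ₐ[ℂ] QSpace q 3}

theorem linear_mem_skewValues (h2 : κ (Z2 q) = q ^ 2 • Z2 q) (h3 : κ (Z3 q) = q • Z3 q) :
    ![Z3 q, 0, 0] ∈ QSpace.skewValues κ (AlgHom.id ℂ _) := by
  refine QSpace.mem_skewValues_three ?_ ?_ ?_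
  · simp [h2, Z3_mul_Z2, smul_smul, pow_two]
  · simp [h3]
  · simp

theorem quadratic_mem_skewValues (hq : q ≠ 0) (h1 : κ (Z1 q) = q⁻¹ • Z1 q)
    (h2 : κ (Z2 q) = q ^ 2 • Z2 q) (h3 : κ (Z3 q) = q • Z3 q) :
    ![Z1 q * Z2 q, -q • Z2 q ^ 2, -q • (Z2 q * Z3 q)] ∈
      QSpace.skewValues κ (AlgHom.id ℂ _) := by
  have h211 : Z2 q * (Z1 q * Z2 q) = q • (Z1 q * Z2 q ^ 2) := by
    rw [← mul_assoc, Z2_mul_Z1, smul_mul_assoc, mul_assoc, pow_two]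
  have h221 : Z2 q ^ 2 * Z1 q = q ^ 2 • (Z1 q * Z2 q ^ 2) := pow_mul_of_qcomm Z2_mul_Z1 2
  have h312 : Z3 q * (Z1 q * Z2 q) = q ^ 2 • (Z1 q * (Z2 q * Z3 q)) := by
    rw [← mul_assoc, Z3_mul_Z1, smul_mul_assoc, mul_assoc, Z3_mul_Z2, mul_smul_comm, smul_smul,
      pow_two]
  have h231 : Z2 q * Z3 q * Z1 q = q ^ 2 • (Z1 q * (Z2 q * Z3 q)) := by
    rw [mul_assoc, Z3_mul_Z1, mul_smul_comm, ← mul_assoc, Z2_mul_Z1, smul_mul_assoc, smul_smul,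
      pow_two, mul_assoc]
  have h322 : Z3 q * Z2 q ^ 2 = q ^ 2 • (Z2 q ^ 2 * Z3 q) := mul_pow_of_qcomm Z3_mul_Z2 2
  have h232 : Z2 q * Z3 q * Z2 q = q • (Z2 q ^ 2 * Z3 q) := by
    rw [mul_assoc, Z3_mul_Z2, mul_smul_comm, ← mul_assoc, pow_two]
  have h223 : Z2 q * (Z2 q * Z3 q) = Z2 q ^ 2 * Z3 q := by rw [← mul_assoc, pow_two]
  have h122 : Z1 q * Z2 q * Z2 q = Z1 q * Z2 q ^ 2 := by rw [mul_assoc, pow_two]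
  have h123 : Z1 q * Z2 q * Z3 q = Z1 q * (Z2 q * Z3 q) := mul_assoc _ _ _
  refine QSpace.mem_skewValues_three ?_ ?_ ?_ <;>
  simp only [h1, h2, h3, AlgHom.id_apply, smul_mul_assoc, mul_smul_comm, h211, h221, h312, h231,
    h322, h232, h223, h122, h123] <;>
  match_scalars <;> field_simp <;> ring

theorem monomial_mem_skewValues (hq : q ≠ 0) (hq' : ∀ N : ℕ, 0 < N → q ^ N ≠ 1)
    (h1 : κ (Z1 q) = q⁻¹ • Z1 q) (h2 : κ (Z2 q) = q ^ 2 • Z2 q) (h3 : κ (Z3 q) = q • Z3 q)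
    (p : ℕ) :
    ![Z1 q ^ (p + 1) * Z3 q ^ (p + 2), 0,
        -(q * qInt q (p + 1) / qInt q (p + 3)) • (Z1 q ^ p * Z3 q ^ (p + 3))] ∈
      QSpace.skewValues κ (AlgHom.id ℂ _) := by
  have h213 (r s : ℕ) : Z2 q * (Z1 q ^ r * Z3 q ^ s) = q ^ r • (Z1 q ^ r * Z2 q * Z3 q ^ s) := by
    rw [← mul_assoc, mul_pow_of_qcomm Z2_mul_Z1, smul_mul_assoc]
  have h132 (r s : ℕ) : Z1 q ^ r * Z3 q ^ s * Z2 q = q ^ s • (Z1 q ^ r * Z2 q * Z3 q ^ s) := by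
    rw [mul_assoc, pow_mul_of_qcomm Z3_mul_Z2, mul_smul_comm, mul_assoc]
  have h313 : Z3 q * (Z1 q ^ (p + 1) * Z3 q ^ (p + 2)) =
      q ^ (p + 1) • (Z1 q ^ (p + 1) * Z3 q ^ (p + 3)) := by
    rw [← mul_assoc, mul_pow_of_qcomm Z3_mul_Z1, smul_mul_assoc, mul_assoc, ← pow_succ']
  have h131 : Z1 q ^ p * Z3 q ^ (p + 3) * Z1 q =
      q ^ (p + 3) • (Z1 q ^ (p + 1) * Z3 q ^ (p + 3)) := by
    rw [mul_assoc, pow_mul_of_qcomm Z3_mul_Z1, mul_smul_comm, ← mul_assoc, ← pow_succ]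
  have h113 : Z1 q * (Z1 q ^ p * Z3 q ^ (p + 3)) = Z1 q ^ (p + 1) * Z3 q ^ (p + 3) := by
    rw [← mul_assoc, ← pow_succ']
  have h133 : Z1 q ^ (p + 1) * Z3 q ^ (p + 2) * Z3 q = Z1 q ^ (p + 1) * Z3 q ^ (p + 3) := by
    rw [mul_assoc, ← pow_succ]
  have hc : q * qInt q (p + 1) / qInt q (p + 3) * (q ^ (p + 3) - 1) = q * (q ^ (p + 1) - 1) := by
    have hq1 : q - 1 ≠ 0 := sub_ne_zero.2 (by simpa using hq' 1 one_pos)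
    have hq3 : q ^ (p + 3) - 1 ≠ 0 := sub_ne_zero.2 (hq' _ (by positivity))
    unfold qInt
    field_simp
  generalize q * qInt q (p + 1) / qInt q (p + 3) = c at hc
  refine QSpace.mem_skewValues_three ?_ ?_ ?_ <;>
  simp only [h1, h2, h3, AlgHom.id_apply, smul_mul_assoc, mul_smul_comm, h213, h132, h313, h131,
    h113, h133, mul_zero, zero_mul, zero_add, add_zero]
  · match_scalars
    ring
  · match_scalars
    field_simp
    linear_combination -hc
  · match_scalars
    ring

end QuantumThreeSpace

/-- The family of `U_q(sl(2))`-module-algebra structures on `A_q(3)` of Lemma 4.7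
(cases `(∗₆)`, `(∗₇)`). -/
theorem Uqsl2_on_Aq3_case67_exists (q : ℂ) (hq : q ≠ 0)
    (hq' : ∀ N : ℕ, 0 < N → q ^ N ≠ 1)
    (n : ℕ) (d₁ : ℂ) (dh : ℕ → ℂ) (b₀ : ℂ) (hb₀ : b₀ ≠ 0) :
    ∃ π : UqslMA q 1 (QSpace q 3),
      π.k 0 (Z1 q) = q • Z1 q ∧
      π.k 0 (Z2 q) = (q ^ (-2 : ℤ)) • Z2 q ∧
      π.k 0 (Z3 q) = q⁻¹ • Z3 q ∧
      π.e 0 (Z1 q) = 0 ∧ π.e 0 (Z2 q) = b₀ • 1 ∧ π.e 0 (Z3 q) = 0 ∧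
      π.f 0 (Z1 q) = d₁ • Z3 q + b₀⁻¹ • (Z1 q * Z2 q)
          + ∑ p ∈ Finset.range (n + 1), dh p • (Z1 q ^ (p + 1) * Z3 q ^ (p + 2)) ∧
      π.f 0 (Z2 q) = (-q * b₀⁻¹) • (Z2 q ^ 2) ∧
      π.f 0 (Z3 q) = (-q * b₀⁻¹) • (Z2 q * Z3 q)
          - ∑ p ∈ Finset.range (n + 1),
              (q * qInt q (p + 1) / qInt q (p + 3) * dh p) • (Z1 q ^ p * Z3 q ^ (p + 3)) := by
  obtain ⟨κ, hκ, hκs⟩ := QSpace.exists_scaling (q := q) ![q, q ^ (-2 : ℤ), q⁻¹] (by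
    intro i
    fin_cases i <;> simp [hq])
  have hk1 : κ (Z1 q) = q • Z1 q := hκ 0
  have hk2 : κ (Z2 q) = q ^ (-2 : ℤ) • Z2 q := hκ 1
  have hk3 : κ (Z3 q) = q⁻¹ • Z3 q := hκ 2
  have hs1 : κ.symm (Z1 q) = q⁻¹ • Z1 q := hκs 0
  have hs2 : κ.symm (Z2 q) = q ^ 2 • Z2 q := by
    simpa [zpow_neg] using! hκs 1
  have hs3 : κ.symm (Z3 q) = q • Z3 q := by
    simpa using! hκs 2
  obtain ⟨e, he, hev⟩ := QSpace.exists_isSkewDerivation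
    (AlgHom.id ℂ (QSpace q 3)) (κ : QSpace q 3 →ₐ[ℂ] QSpace q 3)
    (v := ![0, b₀ • 1, 0]) (by
      refine QSpace.mem_skewValues_three ?_ ?_ ?_
      · simp [hk1, smul_smul]
      · simp
      · simp only [AlgHom.id_apply, AlgEquiv.coe_toAlgHom, hk3, mul_zero, zero_mul, zero_add,
          add_zero, mul_smul_comm, smul_mul_assoc, mul_one, one_mul]
        match_scalars
        field_simp)
  obtain ⟨f, hf, hfv⟩ := QSpace.exists_isSkewDerivation
    (κ.symm : QSpace q 3 →ₐ[ℂ] QSpace q 3) (AlgHom.id ℂ (QSpace q 3))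
    (Submodule.add_mem _ (Submodule.add_mem _
      (Submodule.smul_mem _ d₁ (linear_mem_skewValues hs2 hs3))
      (Submodule.smul_mem _ b₀⁻¹ (quadratic_mem_skewValues hq hs1 hs2 hs3)))
      (Submodule.sum_mem _ (t := Finset.range (n + 1)) fun p _ => Submodule.smul_mem _ (dh p)
        (monomial_mem_skewValues hq hq' hs1 hs2 hs3 p)))
  have he1 : e (Z1 q) = 0 := hev 0
  have he2 : e (Z2 q) = b₀ • 1 := hev 1
  have he3 : e (Z3 q) = 0 := hev 2
  have hf1 : f (Z1 q) = d₁ • Z3 q + b₀⁻¹ • (Z1 q * Z2 q)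
      + ∑ p ∈ Finset.range (n + 1), dh p • (Z1 q ^ (p + 1) * Z3 q ^ (p + 2)) := by
    simpa using! hfv 0
  have hf2 : f (Z2 q) = (-q * b₀⁻¹) • (Z2 q ^ 2) := by
    refine (hfv 1).trans ?_
    simp only [Pi.add_apply, Pi.smul_apply, Finset.sum_apply, Matrix.cons_val, smul_zero,
      Finset.sum_const_zero]
    module
  have hf3 : f (Z3 q) = (-q * b₀⁻¹) • (Z2 q * Z3 q)
      - ∑ p ∈ Finset.range (n + 1),
          (q * qInt q (p + 1) / qInt q (p + 3) * dh p) • (Z1 q ^ p * Z3 q ^ (p + 3)) := by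
    refine (hfv 2).trans ?_
    simp only [Pi.add_apply, Pi.smul_apply, Finset.sum_apply, Matrix.cons_val, smul_zero]
    rw [sub_eq_add_neg, ← Finset.sum_neg_distrib]
    congr 1
    · module
    · exact Finset.sum_congr rfl fun p _ => by module
  replace he : QSpace.IsSkewDerivation id κ e := he
  replace hf : QSpace.IsSkewDerivation κ.symm id f := hf
  have heZ1 (r : ℕ) : e (Z1 q ^ r) = 0 := by
    induction r with
    | zero => simpa using he.map_one
    | succ r ih => rw [pow_succ, he.map_mul, ih, he1, mul_zero, zero_mul, add_zero]
  have heZ3 (r : ℕ) : e (Z3 q ^ r) = 0 := by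
    induction r with
    | zero => simpa using he.map_one
    | succ r ih => rw [pow_succ, he.map_mul, ih, he3, mul_zero, zero_mul, add_zero]
  have heZ (r s : ℕ) : e (Z1 q ^ r * Z3 q ^ s) = 0 := by
    rw [he.map_mul, heZ1, heZ3, mul_zero, zero_mul, add_zero]
  have hκZ (r s : ℕ) : κ (Z1 q ^ r * Z3 q ^ (r + s)) = (q ^ s)⁻¹ • (Z1 q ^ r * Z3 q ^ (r + s)) := by
    rw [map_mul, map_pow, map_pow, hk1, hk3, smul_pow, smul_pow, smul_mul_smul_comm, pow_add,
      ← mul_assoc, ← mul_pow, mul_inv_cancel₀ hq, one_pow, one_mul, inv_pow]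
  have hqq : q - q⁻¹ ≠ 0 := by
    intro h
    refine hq' 2 two_pos ?_
    field_simp at h
    linear_combination h
  obtain ⟨π, rfl, rfl, rfl⟩ := QSpace.exists_uqslMA hq he hf
    (by
      intro i
      fin_cases i
      · change κ (e (κ.symm (Z1 q))) = _ • e (Z1 q)
        simp [hs1, he1]
      · change κ (e (κ.symm (Z2 q))) = _ • e (Z2 q)
        simp only [hs2, he2, map_smul, map_one]
        norm_cast
      · change κ (e (κ.symm (Z3 q))) = _ • e (Z3 q)
        simp [hs3, he3])
    (by
      have hκ1 (p : ℕ) := hκZ (p + 1) 1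
      have hκ3 (p : ℕ) := hκZ p 3
      simp only [add_assoc, Nat.reduceAdd, pow_one] at hκ1
      intro i
      fin_cases i
      · change κ (f (κ.symm (Z1 q))) = _ • f (Z1 q)
        simp only [hs1, hf1, map_smul, map_add, map_sum, hκ1, smul_comm _ q⁻¹, ← Finset.smul_sum,
          map_mul κ (Z1 q) (Z2 q), hk1, hk2, hk3, smul_mul_smul_comm, zpow_neg, zpow_ofNat]
        match_scalars <;> field_simp
      · change κ (f (κ.symm (Z2 q))) = _ • f (Z2 q)
        simp only [hs2, hf2, map_smul, map_pow, hk2, smul_pow, zpow_neg, zpow_ofNat]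
        match_scalars
        field_simp
      · change κ (f (κ.symm (Z3 q))) = _ • f (Z3 q)
        simp only [hs3, hf3, map_smul, map_sub, map_sum, hκ3, smul_comm _ (q ^ 3)⁻¹,
          ← Finset.smul_sum, map_mul κ (Z2 q) (Z3 q), hk2, hk3, smul_mul_smul_comm, zpow_neg,
          zpow_ofNat]
        match_scalars <;> field_simp)
    (by
      intro i
      fin_cases i
      · change e (f (Z1 q)) - f (e (Z1 q)) = _ • (κ (Z1 q) - κ.symm (Z1 q))
        have h : e (Z1 q * Z2 q) = b₀ • Z1 q := by simp [he.map_mul, he1, he2]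
        simp only [hf1, map_add, map_sum, map_smul, heZ, he1, he3, h, hk1, hs1, smul_zero,
          Finset.sum_const_zero, map_zero]
        match_scalars
        linear_combination inv_mul_cancel₀ hb₀ - inv_mul_cancel₀ hqq
      · change e (f (Z2 q)) - f (e (Z2 q)) = _ • (κ (Z2 q) - κ.symm (Z2 q))
        simp only [hf2, pow_two (Z2 q), he.map_mul, he2, map_smul, hf.map_one, hk2, hs2, id,
          mul_smul_comm, smul_mul_assoc, mul_one, one_mul, zpow_neg, zpow_ofNat]
        match_scalars
        linear_combination (-q - q * q⁻¹ ^ 2) * inv_mul_cancel₀ hb₀ - q⁻¹ * mul_inv_cancel₀ hq +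
          (q + q⁻¹) * inv_mul_cancel₀ hqq
      · change e (f (Z3 q)) - f (e (Z3 q)) = _ • (κ (Z3 q) - κ.symm (Z3 q))
        have h : e (Z2 q * Z3 q) = (b₀ * q⁻¹) • Z3 q := by
          simp [he.map_mul, he2, he3, hk3, smul_smul, mul_comm]
        simp only [hf3, map_sub, map_sum, map_smul, heZ, he3, h, hk3, hs3, smul_zero,
          Finset.sum_const_zero, map_zero]
        match_scalars
        linear_combination -q * q⁻¹ * inv_mul_cancel₀ hb₀ - mul_inv_cancel₀ hq +
          inv_mul_cancel₀ hqq)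
  exact ⟨π, hk1, hk2, hk3, he1, he2, he3, hf1, hf2, hf3⟩
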